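/- arXiv:1905.09700 — 2 statements merged into one kernel-verified Lean document; each statement's English description precedes it below -/
import Mathlib

section
/- Let D be a real m×d matrix with nonzero columns d_1,…,d_d, and let μ(D) = max_{i≠j} |d_i^T d_j| / (‖d_i‖₂ ‖d_j‖₂) be its mutual coherence. If the linear system D x = y has a solution x whose number of nonzero entries ‖x‖₀ satisfies ‖x‖₀ < (1/2)(1 + 1/μ(D)), then x is the unique sparsest solution: every other vector z ≠ x with D z = y satisfies ‖z‖₀ > ‖x‖₀. -/
/-- `‖x‖₀`: the number of nonzero entries of `x`. -/
noncomputable def l0 {d : ℕ} (x : Fin d → ℝ) : ℕ :=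
  (Finset.univ.filter fun i => x i ≠ 0).card

/-- The ℓ₂ norm of the `i`-th column of `D`. -/
noncomputable def colNorm {m d : ℕ} (D : Matrix (Fin m) (Fin d) ℝ) (i : Fin d) : ℝ :=
  Real.sqrt (∑ t, (D t i) ^ 2)

/-- The set of normalized absolute inner products between distinct columns of `D`;
its greatest element is the mutual coherence `μ(D)`. -/
def cohSet {m d : ℕ} (D : Matrix (Fin m) (Fin d) ℝ) : Set ℝ :=
  {r | ∃ i j : Fin d, i ≠ j ∧ r = |∑ t, D t i * D t j| / (colNorm D i * colNorm D j)}

theorem l0_sub_le {d : ℕ} (x z : Fin d → ℝ) : l0 (z - x) ≤ l0 z + l0 x := by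
  unfold l0
  refine le_trans (Finset.card_le_card ?_) (Finset.card_union_le _ _)
  intro i hi
  simp only [Finset.mem_filter, Finset.mem_univ, true_and, Finset.mem_union, Pi.sub_apply] at hi ⊢
  by_contra! h
  exact hi (by rw [h.1, h.2, sub_zero])

theorem colNorm_sq {m d : ℕ} (D : Matrix (Fin m) (Fin d) ℝ) (i : Fin d) :
    colNorm D i ^ 2 = ∑ t, D t i * D t i := by
  rw [colNorm, Real.sq_sqrt (Finset.sum_nonneg fun t _ => sq_nonneg _)]
  simp only [sq]

theorem colNorm_pos {m d : ℕ} (D : Matrix (Fin m) (Fin d) ℝ) (i : Fin d)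
    (h : (fun t => D t i) ≠ 0) : 0 < colNorm D i := by
  obtain ⟨t, ht⟩ := Function.ne_iff.mp h
  exact Real.sqrt_pos.mpr <| Finset.sum_pos' (fun t _ => sq_nonneg _)
    ⟨t, Finset.mem_univ t, sq_pos_of_ne_zero ht⟩

/-- A nonzero kernel vector of a matrix of coherence at most `μ` has at least `1 + 1/μ` nonzero
entries, stated without division. -/
theorem one_le_coherence_mul_of_mulVec_eq_zero {m d : ℕ} (D : Matrix (Fin m) (Fin d) ℝ)
    (hcols : ∀ i : Fin d, (fun t => D t i) ≠ 0) {μ : ℝ} (hμ : μ ∈ upperBounds (cohSet D))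
    {v : Fin d → ℝ} (hv : v ≠ 0) (hDv : D.mulVec v = 0) : 1 ≤ μ * ((l0 v : ℝ) - 1) := by
  classical
  have hn i := colNorm_pos D i (hcols i)
  obtain ⟨k, hk⟩ := Function.ne_iff.mp hv
  obtain ⟨i, -, hmax⟩ := Finset.exists_max_image Finset.univ (fun j => colNorm D j * |v j|)
    ⟨k, Finset.mem_univ k⟩
  have hwi : 0 < colNorm D i * |v i| :=
    (mul_pos (hn k) (abs_pos.mpr hk)).trans_le (hmax k (Finset.mem_univ k))
  have hvi : v i ≠ 0 := by
    rintro h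
    simp [h] at hwi
  have hcoh : ∀ j, i ≠ j → |∑ t, D t i * D t j| ≤ μ * (colNorm D i * colNorm D j) := fun j hj =>
    (div_le_iff₀ (mul_pos (hn i) (hn j))).mp (hμ ⟨i, j, hj, rfl⟩)
  set S := Finset.univ.filter fun j => v j ≠ 0 with hS
  have hiS : i ∈ S := by simp [hS, hvi]
  have hgram : ∑ j ∈ S, (∑ t, D t i * D t j) * v j = 0 := by
    rw [Finset.sum_filter_of_ne fun j _ h => right_ne_zero_of_mul h]
    simp_rw [Finset.sum_mul]
    rw [Finset.sum_comm]
    refine Finset.sum_eq_zero fun t _ => ?_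
    have ht : ∑ j, D t j * v j = 0 := congrFun hDv t
    simp_rw [mul_assoc]
    rw [← Finset.mul_sum, ht, mul_zero]
  rw [← Finset.add_sum_erase S _ hiS, ← colNorm_sq] at hgram
  have hcard : ((S.erase i).card : ℝ) = (l0 v : ℝ) - 1 := by
    rw [Finset.card_erase_of_mem hiS, Nat.cast_sub (Finset.card_pos.mpr ⟨i, hiS⟩), Nat.cast_one]
    rfl
  have key : colNorm D i ^ 2 * |v i| ≤
      (S.erase i).card • (μ * (colNorm D i * (colNorm D i * |v i|))) := by
    calc colNorm D i ^ 2 * |v i| = |∑ j ∈ S.erase i, (∑ t, D t i * D t j) * v j| := by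
          rw [← abs_neg (∑ j ∈ S.erase i, _), ← eq_neg_of_add_eq_zero_left hgram, abs_mul,
            abs_of_nonneg (sq_nonneg (colNorm D i))]
      _ ≤ ∑ j ∈ S.erase i, |(∑ t, D t i * D t j) * v j| := Finset.abs_sum_le_sum_abs _ _
      _ ≤ _ := by
          refine Finset.sum_le_card_nsmul _ _ _ fun j hj => ?_
          have hij := (Finset.ne_of_mem_erase hj).symm
          have hμ0 : 0 ≤ μ := nonneg_of_mul_nonneg_left
            ((abs_nonneg _).trans (hcoh j hij)) (mul_pos (hn i) (hn j))
          calc |(∑ t, D t i * D t j) * v j| ≤ μ * (colNorm D i * colNorm D j) * |v j| := by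
                rw [abs_mul]
                exact mul_le_mul_of_nonneg_right (hcoh j hij) (abs_nonneg _)
            _ = μ * (colNorm D i * (colNorm D j * |v j|)) := by ring
            _ ≤ _ := mul_le_mul_of_nonneg_left (mul_le_mul_of_nonneg_left
                (hmax j (Finset.mem_univ j)) (hn i).le) hμ0
  rw [nsmul_eq_mul, hcard] at key
  refine le_of_mul_le_mul_right ?_ (mul_pos (hn i) hwi)
  linarith

/-- Coherence-based uniqueness of sparse solutions (Elad 2010, Thm 2.5):
if `D x = y` with `‖x‖₀ < (1/2)(1 + 1/μ(D))`, then `x` is the unique sparsest solution. -/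
theorem coherence_uniqueness {m d : ℕ} (D : Matrix (Fin m) (Fin d) ℝ)
    (hcols : ∀ i : Fin d, (fun t => D t i) ≠ 0)
    (μ : ℝ) (hμ : IsGreatest (cohSet D) μ)
    (y : Fin m → ℝ) (x : Fin d → ℝ) (hx : D.mulVec x = y)
    (hsparse : (l0 x : ℝ) < (1 / 2) * (1 + 1 / μ)) :
    ∀ z : Fin d → ℝ, z ≠ x → D.mulVec z = y → l0 x < l0 z := by
  intro z hzx hz
  by_contra! hle
  have hbound := one_le_coherence_mul_of_mulVec_eq_zero D hcols hμ.2 (sub_ne_zero.mpr hzx)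
    (by rw [Matrix.mulVec_sub, hz, hx, sub_self])
  have hl0 : (l0 (z - x) : ℝ) ≤ 2 * l0 x := by
    exact_mod_cast (l0_sub_le x z).trans (by lia)
  have hμ0 : 0 ≤ μ := by
    obtain ⟨i, j, -, rfl⟩ := hμ.1
    exact div_nonneg (abs_nonneg _) (mul_nonneg (Real.sqrt_nonneg _) (Real.sqrt_nonneg _))
  have hμpos : 0 < μ := hμ0.lt_of_ne' fun h => by
    rw [h, zero_mul] at hbound
    exact absurd hbound (by norm_num)
  have hdiv : 1 / μ ≤ (l0 (z - x) : ℝ) - 1 := (div_le_iff₀' hμpos).mpr hbound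
  linarith
end

section
/- Let D be a real m×d matrix. Define the spark of D as the smallest number of columns of D that are linearly dependent, i.e., spark(D) = min { ‖z‖₀ : z ∈ ℝ^d, z ≠ 0, D z = 0 }. If the linear system D x = y has a solution x with ‖x‖₀ < spark(D)/2, then x is the unique sparsest solution: every other vector z ≠ x with D z = y satisfies ‖z‖₀ > ‖x‖₀. -/
/-- The set of support sizes of nonzero kernel vectors of `D`;
its least element is `spark(D)`. -/
def sparkSet {m d : ℕ} (D : Matrix (Fin m) (Fin d) ℝ) : Set ℕ :=
  {n | ∃ z : Fin d → ℝ, z ≠ 0 ∧ D.mulVec z = 0 ∧ l0 z = n}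

/-- Spark-based uniqueness of sparse solutions (Donoho–Elad 2003):
if `D x = y` with `‖x‖₀ < spark(D)/2`, then `x` is the unique sparsest solution. -/
theorem spark_uniqueness {m d : ℕ} (D : Matrix (Fin m) (Fin d) ℝ)
    (s : ℕ) (hs : IsLeast (sparkSet D) s)
    (y : Fin m → ℝ) (x : Fin d → ℝ) (hx : D.mulVec x = y)
    (hsparse : (l0 x : ℝ) < (s : ℝ) / 2) :
    ∀ z : Fin d → ℝ, z ≠ x → D.mulVec z = y → l0 x < l0 z := by
  intro z hzx hz
  have hle : s ≤ l0 (z - x) :=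
    hs.2 ⟨z - x, sub_ne_zero.mpr hzx, by rw [Matrix.mulVec_sub, hz, hx, sub_self], rfl⟩
  have htri := l0_sub_le x z
  have hlt : 2 * l0 x < s := by
    have h : (2 * l0 x : ℝ) < s := by linarith
    exact_mod_cast h
  omega
end
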